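/- Let f : ℝ^N → ℝ be concave. If the smallest nonnegative element a_1⁺ of X is strictly positive, then the upper hedging price of the restriction of f to X^N in the N-round game equals the binomial price E_{a_1⁻,a_1⁺}(f), where a_1⁻ is the largest negative element of X; if instead 0 ∈ X, then the upper hedging price equals f(0, 0, …, 0). -/

import Mathlib

noncomputable def capitalAux (P : List ℝ → ℝ) : List ℝ → List ℝ → ℝ
  | _, [] => 0
  | pre, x :: rest => P pre * x + capitalAux P (pre ++ [x]) rest

/-- Upper hedging price of payoff `F` in the `N`-round multinomial game with move space `X`. -/
noncomputable def upperPrice (X : Finset ℝ) (N : ℕ) (F : List ℝ → ℝ) : ℝ :=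
  sInf {α : ℝ | ∃ P : List ℝ → ℝ,
    ∀ ξ : List ℝ, ξ.length = N → (∀ x ∈ ξ, x ∈ X) → F ξ ≤ α + capitalAux P [] ξ}

/-- Lower hedging price. -/
noncomputable def lowerPrice (X : Finset ℝ) (N : ℕ) (F : List ℝ → ℝ) : ℝ :=
  -upperPrice X N (fun ξ => -F ξ)

/-- The binomial price of a European-type payoff `f : ℝ^N → ℝ` for the binomial model
`{an, ap}` with `an < 0 < ap`: the expectation of `f` under the i.i.d. product measure in
which each coordinate equals `an` with probability `ap / (ap - an)` and equals `ap` with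
probability `-an / (ap - an)`. -/
noncomputable def binPrice (N : ℕ) (an ap : ℝ) (f : (Fin N → ℝ) → ℝ) : ℝ :=
  ∑ ε : Fin N → Bool,
    (∏ i, (if ε i then -an else ap) / (ap - an)) * f (fun i => if ε i then ap else an)

theorem capitalAux_append (P : List ℝ → ℝ) (pre l ξ : List ℝ) :
    capitalAux P (pre ++ l) ξ = capitalAux (fun l => P (pre ++ l)) l ξ := by
  induction ξ generalizing l with
  | nil => rfl
  | cons x ξ ih => simp only [capitalAux, List.append_assoc, ih]

theorem capitalAux_nil_cons (P : List ℝ → ℝ) (x : ℝ) (ξ : List ℝ) :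
    capitalAux P [] (x :: ξ) = P [] * x + capitalAux (fun l => P (x :: l)) [] ξ := by
  have h := capitalAux_append P [x] [] ξ
  simp only [List.append_nil, List.cons_append, List.nil_append] at h
  simp only [capitalAux, List.nil_append, h]

theorem binPrice_zero (a b : ℝ) (f : (Fin 0 → ℝ) → ℝ) (z : Fin 0 → ℝ) :
    binPrice 0 a b f = f z := by
  simp only [binPrice, Finset.univ_unique, Finset.sum_singleton, Finset.univ_eq_empty,
    Finset.prod_empty, one_mul]
  exact congrArg f (Subsingleton.elim _ _)

theorem binPrice_succ (n : ℕ) (a b : ℝ) (f : (Fin (n + 1) → ℝ) → ℝ) :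
    binPrice (n + 1) a b f =
      b / (b - a) * binPrice n a b (fun z => f (Fin.cons a z)) +
        -a / (b - a) * binPrice n a b (fun z => f (Fin.cons b z)) := by
  have hcons (c : Bool) (ε : Fin n → Bool) :
      (fun i => if (Fin.cons c ε : Fin (n + 1) → Bool) i then b else a) =
        (Fin.cons (if c then b else a) (fun i => if ε i then b else a) : Fin (n + 1) → ℝ) := by
    funext i
    refine Fin.cases ?_ (fun j => ?_) i <;> simp
  simp only [binPrice]
  rw [← (Fin.consEquiv (fun _ : Fin (n + 1) => Bool)).sum_comp, Fintype.sum_prod_type]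
  simp only [Fin.consEquiv_apply, hcons, Fin.prod_univ_succ, Fin.cons_zero, Fin.cons_succ,
    Fintype.sum_bool, Finset.mul_sum, if_true, Bool.false_eq_true, if_false, mul_assoc]
  exact add_comm _ _

theorem binPrice_zero_left (N : ℕ) {b : ℝ} (hb : b ≠ 0) (f : (Fin N → ℝ) → ℝ) :
    binPrice N 0 b f = f (fun _ => 0) := by
  induction N with
  | zero => exact binPrice_zero 0 b f _
  | succ n ih =>
    have hcons : (Fin.cons 0 (fun _ => 0) : Fin (n + 1) → ℝ) = fun _ => 0 := by
      funext i
      refine Fin.cases ?_ (fun j => ?_) i <;> simp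
    simp [binPrice_succ, ih, hb, hcons]

theorem concaveOn_binPrice (n : ℕ) {a b : ℝ} (ha : a ≤ 0) (hb : 0 ≤ b)
    (h : ℝ → (Fin n → ℝ) → ℝ) (hc : ∀ z, ConcaveOn ℝ Set.univ fun x => h x z) :
    ConcaveOn ℝ Set.univ fun x => binPrice n a b (h x) := by
  refine ⟨convex_univ, fun x _ y _ s t hs ht hst => ?_⟩
  simp only [binPrice, smul_eq_mul, Finset.mul_sum, ← Finset.sum_add_distrib]
  refine Finset.sum_le_sum fun ε _ => ?_
  have hw : 0 ≤ ∏ i, (if ε i then -a else b) / (b - a) :=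
    Finset.prod_nonneg fun i _ => div_nonneg (by split_ifs <;> linarith) (by linarith)
  have := mul_le_mul_of_nonneg_left
    ((hc fun i => if ε i then b else a).2 (Set.mem_univ x) (Set.mem_univ y) hs ht hst) hw
  simp only [smul_eq_mul] at this
  linarith

theorem ConcaveOn.le_secant_of_le_or_le {g : ℝ → ℝ} (hg : ConcaveOn ℝ Set.univ g)
    {a b x : ℝ} (hab : a < b) (hx : x ≤ a ∨ b ≤ x) :
    g x ≤ b / (b - a) * g a + -a / (b - a) * g b + (g b - g a) / (b - a) * x := by
  have hba : 0 < b - a := sub_pos.2 hab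
  have key : (b - a) * g x ≤ (b - x) * g a + (x - a) * g b := by
    rcases hx with hx | hx
    · have hbx : 0 < b - x := by linarith
      have h := hg.2 (Set.mem_univ x) (Set.mem_univ b)
        (div_nonneg hba.le hbx.le) (div_nonneg (sub_nonneg.2 hx) hbx.le)
        (by field_simp; ring)
      have e : ((b - a) / (b - x)) • x + ((a - x) / (b - x)) • b = a := by
        simp only [smul_eq_mul]; field_simp; ring
      rw [e, smul_eq_mul, smul_eq_mul, div_mul_eq_mul_div, div_mul_eq_mul_div, ← add_div,
        div_le_iff₀ hbx] at h
      linarith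
    · have hxa : 0 < x - a := by linarith
      have h := hg.2 (Set.mem_univ a) (Set.mem_univ x)
        (div_nonneg (sub_nonneg.2 hx) hxa.le) (div_nonneg hba.le hxa.le)
        (by field_simp; ring)
      have e : ((x - b) / (x - a)) • a + ((b - a) / (x - a)) • x = b := by
        simp only [smul_eq_mul]; field_simp; ring
      rw [e, smul_eq_mul, smul_eq_mul, div_mul_eq_mul_div, div_mul_eq_mul_div, ← add_div,
        div_le_iff₀ hxa] at h
      linarith
  have e : b / (b - a) * g a + -a / (b - a) * g b + (g b - g a) / (b - a) * x =
      ((b - x) * g a + (x - a) * g b) / (b - a) := by ring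
  rw [e, le_div_iff₀ hba]
  linarith

theorem cons_getD_eq_finCons (n : ℕ) (x : ℝ) (ξ : List ℝ) :
    (fun i : Fin (n + 1) => (x :: ξ).getD (i : ℕ) 0) =
      Fin.cons x (fun i : Fin n => ξ.getD (i : ℕ) 0) := by
  funext i
  refine Fin.cases ?_ (fun j => ?_) i <;> simp

theorem exists_hedge_binPrice (X : Finset ℝ) {a b : ℝ} (ha : a ≤ 0) (hb : 0 ≤ b) (hab : a < b)
    (hX : ∀ x ∈ X, x ≤ a ∨ b ≤ x) (N : ℕ) (f : (Fin N → ℝ) → ℝ)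
    (hf : ConcaveOn ℝ Set.univ f) :
    ∃ P : List ℝ → ℝ, ∀ ξ : List ℝ, ξ.length = N → (∀ x ∈ ξ, x ∈ X) →
      f (fun i => ξ.getD (i : ℕ) 0) ≤ binPrice N a b f + capitalAux P [] ξ := by
  induction N with
  | zero =>
    refine ⟨fun _ => 0, fun ξ hξ _ => ?_⟩
    obtain rfl := List.length_eq_zero_iff.1 hξ
    rw [binPrice_zero a b f (fun i => ([] : List ℝ).getD (i : ℕ) 0)]
    simp [capitalAux]
  | succ n ih =>
    have hcons (s t x y : ℝ) (z w : Fin n → ℝ) :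
        s • (Fin.cons x z : Fin (n + 1) → ℝ) + t • (Fin.cons y w : Fin (n + 1) → ℝ) =
          Fin.cons (s • x + t • y) (s • z + t • w) := by
      funext i
      refine Fin.cases ?_ (fun j => ?_) i <;> simp
    have htail (x : ℝ) : ConcaveOn ℝ Set.univ fun z : Fin n → ℝ => f (Fin.cons x z) := by
      refine ⟨convex_univ, fun z _ w _ s t hs ht hst => ?_⟩
      have h := hf.2 (Set.mem_univ (Fin.cons x z)) (Set.mem_univ (Fin.cons x w)) hs ht hst
      rwa [hcons, Convex.combo_self hst] at h
    have hhead (z : Fin n → ℝ) : ConcaveOn ℝ Set.univ fun x : ℝ => f (Fin.cons x z) := by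
      refine ⟨convex_univ, fun x _ y _ s t hs ht hst => ?_⟩
      have h := hf.2 (Set.mem_univ (Fin.cons x z)) (Set.mem_univ (Fin.cons y z)) hs ht hst
      rwa [hcons, Convex.combo_self hst] at h
    have hg := concaveOn_binPrice n ha hb (fun x z => f (Fin.cons x z)) hhead
    choose Q hQ using fun x => ih _ (htail x)
    set m := (binPrice n a b (fun z => f (Fin.cons b z)) -
      binPrice n a b (fun z => f (Fin.cons a z))) / (b - a)
    refine ⟨fun l => l.casesOn m Q, fun ξ hξ hmem => ?_⟩
    cases ξ with
    | nil => simp at hξ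
    | cons x ξ =>
      have h₁ := hQ x ξ (by simpa using hξ) fun y hy => hmem y (List.mem_cons_of_mem _ hy)
      have h₂ := hg.le_secant_of_le_or_le hab (hX x (hmem x List.mem_cons_self))
      rw [capitalAux_nil_cons, cons_getD_eq_finCons, binPrice_succ]
      simp only at h₁ h₂ ⊢
      linarith

theorem binPrice_le_of_hedge (X : Finset ℝ) {a b : ℝ} (ha : a ≤ 0) (hb : 0 ≤ b) (hab : a < b)
    (haX : a ∈ X) (hbX : b ∈ X) (N : ℕ) (f : (Fin N → ℝ) → ℝ) (α : ℝ) (P : List ℝ → ℝ)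
    (hP : ∀ ξ : List ℝ, ξ.length = N → (∀ x ∈ ξ, x ∈ X) →
      f (fun i => ξ.getD (i : ℕ) 0) ≤ α + capitalAux P [] ξ) :
    binPrice N a b f ≤ α := by
  induction N generalizing α P with
  | zero =>
    rw [binPrice_zero a b f (fun i => ([] : List ℝ).getD (i : ℕ) 0)]
    simpa [capitalAux] using hP [] rfl (by simp)
  | succ n ih =>
    have hstep (x : ℝ) (hx : x ∈ X) :
        binPrice n a b (fun z => f (Fin.cons x z)) ≤ α + P [] * x := by
      refine ih _ _ (fun l => P (x :: l)) fun ξ hξ hmem => ?_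
      have h := hP (x :: ξ) (by simp [hξ]) (List.forall_mem_cons.2 ⟨hx, hmem⟩)
      rw [capitalAux_nil_cons, cons_getD_eq_finCons] at h
      linarith
    have hba : 0 < b - a := sub_pos.2 hab
    rw [binPrice_succ]
    calc _ ≤ b / (b - a) * (α + P [] * a) + -a / (b - a) * (α + P [] * b) :=
          add_le_add
            (mul_le_mul_of_nonneg_left (hstep a haX) (div_nonneg hb hba.le))
            (mul_le_mul_of_nonneg_left (hstep b hbX) (div_nonneg (neg_nonneg.2 ha) hba.le))
      _ = α := by field_simp; ring

theorem upperPrice_eq_binPrice (X : Finset ℝ) {a b : ℝ} (ha : a ≤ 0) (hb : 0 ≤ b) (hab : a < b)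
    (haX : a ∈ X) (hbX : b ∈ X) (hX : ∀ x ∈ X, x ≤ a ∨ b ≤ x) (N : ℕ) (f : (Fin N → ℝ) → ℝ)
    (hf : ConcaveOn ℝ Set.univ f) :
    upperPrice X N (fun ξ => f (fun i => ξ.getD (i : ℕ) 0)) = binPrice N a b f :=
  IsLeast.csInf_eq ⟨exists_hedge_binPrice X ha hb hab hX N f hf,
    fun α ⟨P, hP⟩ => binPrice_le_of_hedge X ha hb hab haX hbX N f α P hP⟩

/-- For a concave payoff `f : ℝ^N → ℝ`: if the smallest nonnegative element `a1pos` of `X`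
is strictly positive then the upper hedging price of the restriction of `f` to `X^N` is the
binomial price for the two innermost values; if instead `0 ∈ X` then it equals `f (0, …, 0)`. -/
theorem upper_price_concave (X : Finset ℝ)
    (hneg : ∃ a ∈ X, a < 0) (hpos : ∃ a ∈ X, 0 < a)
    (N : ℕ) (f : (Fin N → ℝ) → ℝ) (hf : ConcaveOn ℝ Set.univ f)
    (a1neg a1pos : ℝ)
    (ha1n : IsGreatest {x : ℝ | x ∈ X ∧ x < 0} a1neg)
    (ha1p : IsLeast {x : ℝ | x ∈ X ∧ 0 ≤ x} a1pos) :
    (0 < a1pos →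
      upperPrice X N (fun ξ => f (fun i => ξ.getD (i : ℕ) 0)) = binPrice N a1neg a1pos f) ∧
    ((0 : ℝ) ∈ X →
      upperPrice X N (fun ξ => f (fun i => ξ.getD (i : ℕ) 0)) = f (fun _ => 0)) := by
  refine ⟨fun h => ?_, fun h0 => ?_⟩
  · refine upperPrice_eq_binPrice X ha1n.1.2.le h.le (ha1n.1.2.trans h) ha1n.1.1 ha1p.1.1
      (fun x hx => ?_) N f hf
    rcases lt_or_ge x 0 with hx0 | hx0
    · exact Or.inl (ha1n.2 ⟨hx, hx0⟩)
    · exact Or.inr (ha1p.2 ⟨hx, hx0⟩)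
  · obtain ⟨c, hcX, hc⟩ := hpos
    obtain ⟨b, hb, hmin⟩ := (X.filter (0 < ·)).exists_min_image id
      ⟨c, Finset.mem_filter.2 ⟨hcX, hc⟩⟩
    rw [Finset.mem_filter] at hb
    rw [upperPrice_eq_binPrice X le_rfl hb.2.le hb.2 h0 hb.1 (fun x hx => ?_) N f hf,
      binPrice_zero_left N hb.2.ne']
    rcases le_or_gt x 0 with hx0 | hx0
    · exact Or.inl hx0
    · exact Or.inr (hmin x (Finset.mem_filter.2 ⟨hx, hx0⟩))
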